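/- Suppose there exist symmetric positive definite matrices P̄_i ∈ ℝ^{n_x×n_x} and matrices X_i ∈ ℝ^{n_x×n_x} (i = 1,…,N) such that the 2×2 block matrix [[X_i + X_iᵀ − P̄_j, X_iA_i],[A_iᵀX_iᵀ, P̄_i]] is positive definite for all i, j ∈ {1,…,N}. Then the function V(π,x) = xᵀP(π)x is a poly-quadratic Lyapunov function for x_{k+1} = A(p_k)x_k; in particular, the polytopic system is poly-quadratically stable. -/

import Mathlib

open Matrix

/-- A positive definite real quadratic form is bounded below and above by positive multiples of
the squared Euclidean norm. -/
theorem Matrix.PosDef.exists_quadForm_bounds {n : Type*} [Fintype n]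
    {M : Matrix n n ℝ} (hM : M.PosDef) :
    ∃ a b : ℝ, 0 < a ∧ 0 < b ∧
      ∀ x : n → ℝ, a * (x ⬝ᵥ x) ≤ x ⬝ᵥ (M *ᵥ x) ∧ x ⬝ᵥ (M *ᵥ x) ≤ b * (x ⬝ᵥ x) := by
  have hpos : ∀ x : n → ℝ, x ≠ 0 → 0 < x ⬝ᵥ (M *ᵥ x) := fun x hx ↦ by
    simpa using hM.dotProduct_mulVec_pos hx
  have hself : ∀ x : n → ℝ, x ≠ 0 → 0 < x ⬝ᵥ x := fun x hx ↦ by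
    simpa using dotProduct_star_self_pos_iff.mpr hx
  rcases isEmpty_or_nonempty n with hn | hn
  · exact ⟨1, 1, one_pos, one_pos, fun x ↦ by simp [dotProduct]⟩
  let g : (n → ℝ) → ℝ := fun x ↦ (x ⬝ᵥ (M *ᵥ x)) / (x ⬝ᵥ x)
  have hne : ∀ x ∈ Metric.sphere (0 : n → ℝ) 1, x ≠ 0 := fun x hx ↦
    ne_zero_of_mem_unit_sphere ⟨x, hx⟩
  have hg : ContinuousOn g (Metric.sphere 0 1) := by
    refine ContinuousOn.div (Continuous.continuousOn ?_) (Continuous.continuousOn ?_)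
      fun x hx ↦ (hself x (hne x hx)).ne'
    · fun_prop
    · fun_prop
  have hnonempty : (Metric.sphere (0 : n → ℝ) 1).Nonempty :=
    NormedSpace.sphere_nonempty.mpr one_pos.le
  obtain ⟨y, hy, hmin⟩ := (isCompact_sphere (0 : n → ℝ) 1).exists_isMinOn hnonempty hg
  obtain ⟨z, hz, hmax⟩ := (isCompact_sphere (0 : n → ℝ) 1).exists_isMaxOn hnonempty hg
  have hgpos : ∀ x ∈ Metric.sphere (0 : n → ℝ) 1, 0 < g x := fun x hx ↦
    div_pos (hpos x (hne x hx)) (hself x (hne x hx))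
  refine ⟨g y, g z, hgpos y hy, hgpos z hz, fun x ↦ ?_⟩
  rcases eq_or_ne x 0 with rfl | hx
  · simp
  have hmem : ‖x‖⁻¹ • x ∈ Metric.sphere (0 : n → ℝ) 1 := by
    simp [norm_smul, norm_ne_zero_iff.mpr hx]
  have hscale : g (‖x‖⁻¹ • x) = g x := by
    have : ‖x‖ ≠ 0 := norm_ne_zero_iff.mpr hx
    have := (hself x hx).ne'
    simp only [g, mulVec_smul, smul_dotProduct, dotProduct_smul, smul_eq_mul]
    field_simp
  have h₁ : g y ≤ g x := hscale ▸ hmin hmem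
  have h₂ : g x ≤ g z := hscale ▸ hmax hmem
  exact ⟨(le_div_iff₀ (hself x hx)).mp h₁, (div_le_iff₀ (hself x hx)).mp h₂⟩

/-- The quadratic form of a convex combination of matrices. -/
theorem dotProduct_sum_smul_mulVec {ι n : Type*} [Fintype ι] [Fintype n]
    (c : ι → ℝ) (M : ι → Matrix n n ℝ) (x y : n → ℝ) :
    x ⬝ᵥ ((∑ i, c i • M i) *ᵥ y) = ∑ i, c i * (x ⬝ᵥ (M i *ᵥ y)) := by
  simp [sum_mulVec, dotProduct_sum, smul_mulVec]

/-- Jensen's inequality for a positive semidefinite quadratic form. -/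
theorem Matrix.PosSemidef.quadForm_sum_smul_le {ι n : Type*} [Fintype ι] [Fintype n]
    {Q : Matrix n n ℝ} (hQ : Q.PosSemidef) {c : ι → ℝ} (hc : ∀ i, 0 ≤ c i) (hc1 : ∑ i, c i = 1)
    (v : ι → n → ℝ) :
    (∑ i, c i • v i) ⬝ᵥ (Q *ᵥ ∑ i, c i • v i) ≤ ∑ i, c i * (v i ⬝ᵥ (Q *ᵥ v i)) := by
  set w := ∑ i, c i • v i with hw
  have hsymm : ∀ x y : n → ℝ, x ⬝ᵥ (Q *ᵥ y) = y ⬝ᵥ (Q *ᵥ x) := fun x y ↦ by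
    have hT : Qᵀ = Q := by simpa using hQ.isHermitian.eq
    rw [dotProduct_mulVec, ← mulVec_transpose, hT, dotProduct_comm]
  have hlin : ∑ i, c i * (v i ⬝ᵥ (Q *ᵥ w)) = w ⬝ᵥ (Q *ᵥ w) := by
    conv_rhs => rw [hw, sum_dotProduct]
    simp [smul_dotProduct, hw]
  have hi : ∀ i, c i * (2 * (v i ⬝ᵥ (Q *ᵥ w)) - w ⬝ᵥ (Q *ᵥ w)) ≤ c i * (v i ⬝ᵥ (Q *ᵥ v i)) := by
    refine fun i ↦ mul_le_mul_of_nonneg_left ?_ (hc i)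
    have h : 0 ≤ (v i - w) ⬝ᵥ (Q *ᵥ (v i - w)) := by
      simpa using hQ.dotProduct_mulVec_nonneg (v i - w)
    simp only [mulVec_sub, sub_dotProduct, dotProduct_sub] at h
    linarith [hsymm (v i) w]
  calc w ⬝ᵥ (Q *ᵥ w)
      = 2 * ∑ i, c i * (v i ⬝ᵥ (Q *ᵥ w)) - (∑ i, c i) * (w ⬝ᵥ (Q *ᵥ w)) := by
        rw [hlin, hc1]; ring
    _ = ∑ i, c i * (2 * (v i ⬝ᵥ (Q *ᵥ w)) - w ⬝ᵥ (Q *ᵥ w)) := by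
        rw [Finset.mul_sum, Finset.sum_mul, ← Finset.sum_sub_distrib]
        exact Finset.sum_congr rfl fun i _ ↦ by ring
    _ ≤ _ := Finset.sum_le_sum fun i _ ↦ hi i

/-- Eliminating the slack variable `X` from the observer-form LMI yields the Lyapunov inequality. -/
theorem posDef_sub_of_slack_posDef {n : Type*} [Fintype n]
    {A P Q X : Matrix n n ℝ} (hP : P.PosDef) (hQ : Q.PosDef)
    (h : (fromBlocks (X + Xᵀ - Q) (X * A) (Aᵀ * Xᵀ) P).PosDef) :
    (P - Aᵀ * Q * A).PosDef := by
  classical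
  have hform : ∀ u x : n → ℝ, (u ≠ 0 ∨ x ≠ 0) →
      0 < 2 * (u ⬝ᵥ (Xᵀ *ᵥ u)) - u ⬝ᵥ (Q *ᵥ u) - 2 * ((Xᵀ *ᵥ u) ⬝ᵥ (A *ᵥ x))
        + x ⬝ᵥ (P *ᵥ x) := by
    intro u x hux
    have hne : Sum.elim u (-x) ≠ 0 := by
      intro h0
      have hu : u = 0 := funext fun i ↦ congrFun h0 (Sum.inl i)
      have hx : x = 0 := funext fun i ↦ neg_eq_zero.mp (congrFun h0 (Sum.inr i))
      tauto
    have key := h.dotProduct_mulVec_pos hne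
    have hX : u ⬝ᵥ (X *ᵥ u) = u ⬝ᵥ (Xᵀ *ᵥ u) := by
      rw [mulVec_transpose, dotProduct_mulVec, dotProduct_comm]
    have hXA : u ⬝ᵥ (X *ᵥ (A *ᵥ x)) = (Xᵀ *ᵥ u) ⬝ᵥ (A *ᵥ x) := by
      rw [mulVec_transpose, dotProduct_mulVec]
    have hAX : x ⬝ᵥ (Aᵀ *ᵥ (Xᵀ *ᵥ u)) = (Xᵀ *ᵥ u) ⬝ᵥ (A *ᵥ x) := by
      rw [mulVec_transpose A, dotProduct_comm, dotProduct_mulVec]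
    simp only [star_trivial, fromBlocks_mulVec, sumElim_dotProduct_sumElim, add_mulVec, sub_mulVec,
      Sum.elim_comp_inl, Sum.elim_comp_inr, mulVec_neg, ← mulVec_mulVec, dotProduct_add,
      dotProduct_sub, neg_dotProduct, dotProduct_neg, hX, hXA, hAX] at key
    linarith
  have hinj : Function.Injective (Xᵀ).mulVecLin := by
    refine (injective_iff_map_eq_zero _).mpr fun u hu ↦ ?_
    by_contra hne
    have hu' : Xᵀ *ᵥ u = 0 := hu
    have h₁ := hform u 0 (Or.inl hne)
    have h₂ : 0 < u ⬝ᵥ (Q *ᵥ u) := by simpa using hQ.dotProduct_mulVec_pos hne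
    simp [hu'] at h₁
    linarith
  have hsurj := LinearMap.injective_iff_surjective.mp hinj
  have hQT : Qᵀ = Q := by simpa using hQ.isHermitian.eq
  have hPT : Pᵀ = P := by simpa using hP.isHermitian.eq
  refine PosDef.of_dotProduct_mulVec_pos ?_ fun {x} hx ↦ ?_
  · simp [IsHermitian, Matrix.mul_assoc, hQT, hPT]
  obtain ⟨u, hu⟩ := hsurj (Q *ᵥ (A *ᵥ x))
  have hu' : Xᵀ *ᵥ u = Q *ᵥ (A *ᵥ x) := hu
  have h₁ := hform u x (Or.inr hx)
  have h₂ : 0 ≤ (u - A *ᵥ x) ⬝ᵥ (Q *ᵥ (u - A *ᵥ x)) := by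
    simpa using hQ.posSemidef.dotProduct_mulVec_nonneg (u - A *ᵥ x)
  have h₃ : (A *ᵥ x) ⬝ᵥ (Q *ᵥ u) = u ⬝ᵥ (Q *ᵥ (A *ᵥ x)) := by
    rw [dotProduct_mulVec, ← mulVec_transpose, hQT, dotProduct_comm]
  have h₄ : x ⬝ᵥ (Aᵀ *ᵥ (Q *ᵥ (A *ᵥ x))) = (A *ᵥ x) ⬝ᵥ (Q *ᵥ (A *ᵥ x)) := by
    rw [dotProduct_mulVec, vecMul_transpose]
  rw [hu', dotProduct_comm (Q *ᵥ (A *ᵥ x))] at h₁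
  simp only [mulVec_sub, sub_dotProduct, dotProduct_sub] at h₂
  simp only [star_trivial, sub_mulVec, dotProduct_sub, ← mulVec_mulVec, h₄]
  linarith

/-- Lemma 1 (L1.3 ⇒ L1.1): the observer-form slack-variable LMIs imply that
`V(π,x) = xᵀP(π)x` is a poly-quadratic Lyapunov function for the polytopic
system `x_{k+1} = A(p_k)x_k`; in particular the system is poly-quadratically
stable. -/
theorem lmi_dual_implies_polyQS (nx np N : ℕ) (hnx : 0 < nx) (hnp : 0 < np) (hN : 0 < N)
    (Pset : Set (Fin np → ℝ)) (hPc : IsCompact Pset)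
    (ξ : Fin N → Pset → ℝ)
    (hξc : ∀ i, Continuous (ξ i))
    (hξ0 : ∀ i π, 0 ≤ ξ i π)
    (hξ1 : ∀ π, ∑ i, ξ i π = 1)
    (A Pb X : Fin N → Matrix (Fin nx) (Fin nx) ℝ)
    (hPb : ∀ i, (Pb i).PosDef)
    (hLMI : ∀ i j, (fromBlocks (X i + (X i)ᵀ - Pb j) (X i * A i)
        ((A i)ᵀ * (X i)ᵀ) (Pb i)).PosDef) :
    ∃ a₁ a₂ a₃ : ℝ, 0 < a₁ ∧ 0 < a₂ ∧ 0 < a₃ ∧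
      (∀ (π : Pset) (x : Fin nx → ℝ),
        a₁ * (x ⬝ᵥ x) ≤ x ⬝ᵥ ((∑ i, ξ i π • Pb i) *ᵥ x) ∧
        x ⬝ᵥ ((∑ i, ξ i π • Pb i) *ᵥ x) ≤ a₂ * (x ⬝ᵥ x)) ∧
      (∀ (π πplus : Pset) (x : Fin nx → ℝ),
        ((∑ i, ξ i π • A i) *ᵥ x) ⬝ᵥ
            ((∑ i, ξ i πplus • Pb i) *ᵥ ((∑ i, ξ i π • A i) *ᵥ x))
          ≤ x ⬝ᵥ ((∑ i, ξ i π • Pb i) *ᵥ x) - a₃ * (x ⬝ᵥ x)) := by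
  have hN' : Nonempty (Fin N) := ⟨⟨0, hN⟩⟩
  choose a b ha hb hab using fun i ↦ (hPb i).exists_quadForm_bounds
  choose d _ hd _ hdM using fun ij : Fin N × Fin N ↦
    (posDef_sub_of_slack_posDef (hPb ij.1) (hPb ij.2) (hLMI ij.1 ij.2)).exists_quadForm_bounds
  obtain ⟨ia, hia⟩ := Finite.exists_min a
  obtain ⟨ib, hib⟩ := Finite.exists_max b
  obtain ⟨ij₀, hij₀⟩ := Finite.exists_min d
  have hself : ∀ x : Fin nx → ℝ, 0 ≤ x ⬝ᵥ x := fun x ↦ by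
    simpa using dotProduct_star_self_nonneg x
  have hconst : ∀ (π : Pset) (r : ℝ), ∑ i, ξ i π * r = r := fun π r ↦ by
    rw [← Finset.sum_mul, hξ1, one_mul]
  refine ⟨a ia, b ib, d ij₀, ha ia, hb ib, hd ij₀, fun π x ↦ ?_, fun π πplus x ↦ ?_⟩
  · rw [dotProduct_sum_smul_mulVec]
    constructor
    · rw [← hconst π (a ia * (x ⬝ᵥ x))]
      exact Finset.sum_le_sum fun i _ ↦ mul_le_mul_of_nonneg_left
        ((mul_le_mul_of_nonneg_right (hia i) (hself x)).trans (hab i x).1) (hξ0 i π)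
    · rw [← hconst π (b ib * (x ⬝ᵥ x))]
      exact Finset.sum_le_sum fun i _ ↦ mul_le_mul_of_nonneg_left
        ((hab i x).2.trans (mul_le_mul_of_nonneg_right (hib i) (hself x))) (hξ0 i π)
  · have hvertex : ∀ i j, (A i *ᵥ x) ⬝ᵥ (Pb j *ᵥ (A i *ᵥ x))
        ≤ x ⬝ᵥ (Pb i *ᵥ x) - d ij₀ * (x ⬝ᵥ x) := fun i j ↦ by
      have h₁ := (hdM (i, j) x).1
      have h₂ := mul_le_mul_of_nonneg_right (hij₀ (i, j)) (hself x)
      have h₃ : x ⬝ᵥ ((A i)ᵀ *ᵥ (Pb j *ᵥ (A i *ᵥ x)))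
          = (A i *ᵥ x) ⬝ᵥ (Pb j *ᵥ (A i *ᵥ x)) := by
        rw [dotProduct_mulVec, vecMul_transpose]
      simp only [sub_mulVec, dotProduct_sub, ← mulVec_mulVec, h₃] at h₁
      linarith
    have hpsd : (∑ j, ξ j πplus • Pb j).PosSemidef :=
      posSemidef_sum _ fun j _ ↦ (hPb j).posSemidef.smul (hξ0 j πplus)
    have hAx : (∑ i, ξ i π • A i) *ᵥ x = ∑ i, ξ i π • (A i *ᵥ x) := by
      simp [sum_mulVec, smul_mulVec]
    rw [hAx]
    refine (hpsd.quadForm_sum_smul_le (hξ0 · π) (hξ1 π) _).trans ?_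
    rw [dotProduct_sum_smul_mulVec, ← hconst π (d ij₀ * (x ⬝ᵥ x)), ← Finset.sum_sub_distrib]
    refine Finset.sum_le_sum fun i _ ↦ ?_
    rw [← mul_sub, dotProduct_sum_smul_mulVec]
    refine mul_le_mul_of_nonneg_left ?_ (hξ0 i π)
    rw [← hconst πplus (x ⬝ᵥ (Pb i *ᵥ x) - d ij₀ * (x ⬝ᵥ x))]
    exact Finset.sum_le_sum fun j _ ↦ mul_le_mul_of_nonneg_left (hvertex i j) (hξ0 j πplus)
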